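/- arXiv:1508.00845 — 2 statements merged into one kernel-verified Lean document; each statement's English description precedes it below -/
import Mathlib

section
/- Let α < 0 and let Λ be a locally finite Borel measure on (0,∞) satisfying Λ(A) = Λ(mA) for every Borel set A ⊆ (0,∞). Then for every z ∈ [0,1) the integral G(z) = ∫₀^∞ e^{(H(z)−1)x}·x^{−α} Λ(dx) is finite, there exist nonnegative reals ν(n), n ≥ 0, such that G(z) = ∑_{n≥0} ν(n)·zⁿ for all z ∈ [0,1), and the measure ν on ℕ so defined is a true m^α-invariant measure of the BGW process. -/
open MeasureTheory Real Set

/-- `convPow q i j` is the `i`-fold convolution power of the offspring distribution `q`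
evaluated at `j`, i.e. the transition matrix `P₀(i,j)` of the BGW process. -/
noncomputable def convPow (q : ℕ → ℝ) : ℕ → ℕ → ℝ
  | 0, j => if j = 0 then 1 else 0
  | i + 1, j => ∑ k ∈ Finset.range (j + 1), convPow q i (j - k) * q k

/-- `ν` is a `lam`-invariant measure on `ℕ* = {1,2,…}` of the BGW process killed at 0. -/
def IsInvMeasure (q : ℕ → ℝ) (lam : ℝ) (ν : ℕ → ℝ) : Prop :=
  (∀ n, 0 ≤ ν n) ∧ ν 0 = 0 ∧
  ∀ j : ℕ, 1 ≤ j →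
    Summable (fun i => ν i * convPow q i j) ∧
    ∑' i, ν i * convPow q i j = lam * ν j

/-- `ν` is a true `lam`-invariant measure on `ℕ` of the (non-killed) BGW process. -/
def IsTrueInvMeasure (q : ℕ → ℝ) (lam : ℝ) (ν : ℕ → ℝ) : Prop :=
  (∀ n, 0 ≤ ν n) ∧
  ∀ j : ℕ,
    Summable (fun i => ν i * convPow q i j) ∧
    ∑' i, ν i * convPow q i j = lam * ν j

/-- `Λ` is a locally finite Borel measure on `(0,∞)` (viewed as a measure on `ℝ` giving
no mass to `(-∞,0]` and finite mass to compact subsets of `(0,∞)`). -/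
def IsLocFiniteOnPos (Λ : Measure ℝ) : Prop :=
  Λ (Set.Iic 0) = 0 ∧ ∀ K : Set ℝ, IsCompact K → K ⊆ Set.Ioi 0 → Λ K < ⊤

/-- `Λ(A) = Λ(mA)` for every Borel set `A ⊆ (0,∞)`. -/
def ScaleInvariant (m : ℝ) (Λ : Measure ℝ) : Prop :=
  ∀ A : Set ℝ, MeasurableSet A → A ⊆ Set.Ioi 0 →
    Λ A = Λ ((fun x => m * x) '' A)

open scoped ENNReal

noncomputable def gE (a : ℕ → ℝ) (z : ℝ≥0∞) : ℝ≥0∞ := ∑' k, ENNReal.ofReal (a k) * z ^ k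

lemma convPow_nonneg' (a : ℕ → ℝ) (ha : ∀ k, 0 ≤ a k) (i j : ℕ) : 0 ≤ convPow a i j := by
  induction i generalizing j with
  | zero => unfold convPow; split_ifs <;> norm_num
  | succ i ih =>
    unfold convPow
    exact Finset.sum_nonneg fun k _ => mul_nonneg (ih _) (ha k)

lemma ennreal_cauchy (f g : ℕ → ℝ≥0∞) :
    (∑' n, ∑ k ∈ Finset.range (n + 1), f (n - k) * g k) = (∑' n, f n) * ∑' n, g n := by
  have h1 : ∀ n, ∑ k ∈ Finset.range (n + 1), f (n - k) * g k
      = ∑' p : Finset.HasAntidiagonal.antidiagonal n, f p.1.2 * g p.1.1 := by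
    intro n
    rw [Finset.tsum_subtype (Finset.HasAntidiagonal.antidiagonal n) (fun p => f p.2 * g p.1),
      Finset.Nat.sum_antidiagonal_eq_sum_range_succ (fun k l => f l * g k)]
  simp_rw [h1]
  rw [← ENNReal.tsum_sigma' (fun s : Σ n : ℕ, Finset.HasAntidiagonal.antidiagonal n => f s.2.1.2 * g s.2.1.1),
    ← Finset.HasAntidiagonal.sigmaAntidiagonalEquivProd.symm.tsum_eq]
  simp only [Finset.HasAntidiagonal.sigmaAntidiagonalEquivProd_symm_apply_snd_coe]
  rw [ENNReal.tsum_prod' , ENNReal.tsum_comm, ← ENNReal.tsum_mul_right]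
  simp_rw [ENNReal.tsum_mul_left]

lemma gE_pow (a : ℕ → ℝ) (ha : ∀ k, 0 ≤ a k) (z : ℝ≥0∞) (i : ℕ) :
    ∑' j, ENNReal.ofReal (convPow a i j) * z ^ j = gE a z ^ i := by
  induction i with
  | zero =>
    rw [tsum_eq_single 0]
    · simp [convPow]
    · intro j hj; simp [convPow, hj]
  | succ i ih =>
    rw [pow_succ, ← ih, gE, ← ennreal_cauchy]
    refine tsum_congr fun j => ?_
    rw [convPow, ENNReal.ofReal_sum_of_nonneg
      (fun k _ => mul_nonneg (convPow_nonneg' a ha _ _) (ha k)), Finset.sum_mul]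
    refine Finset.sum_congr rfl fun k hk => ?_
    have : j = (j - k) + k := by have := Finset.mem_range.1 hk; omega
    rw [ENNReal.ofReal_mul (convPow_nonneg' a ha _ _)]
    conv_lhs => rw [this, pow_add]
    simp only [Nat.add_sub_cancel]
    ring

lemma gE_comp (a : ℕ → ℝ) (ha : ∀ k, 0 ≤ a k) (z : ℝ≥0∞) (b : ℕ → ℝ≥0∞) :
    ∑' j, (∑' i, b i * ENNReal.ofReal (convPow a i j)) * z ^ j = ∑' i, b i * gE a z ^ i := by
  simp_rw [← ENNReal.tsum_mul_right]
  rw [ENNReal.tsum_comm]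
  refine tsum_congr fun i => ?_
  rw [← gE_pow a ha, ← ENNReal.tsum_mul_left]
  refine tsum_congr fun j => ?_
  ring

lemma gE_ofReal (a : ℕ → ℝ) (ha : ∀ k, 0 ≤ a k) (hs : Summable a) (z : ℝ) (hz : 0 ≤ z)
    (hz1 : z ≤ 1) : Summable (fun n => a n * z ^ n) ∧
    gE a (ENNReal.ofReal z) = ENNReal.ofReal (∑' n, a n * z ^ n) := by
  have h : Summable (fun n => a n * z ^ n) :=
    Summable.of_nonneg_of_le (fun n => mul_nonneg (ha n) (pow_nonneg hz n))
      (fun n => mul_le_of_le_one_right (ha n) (pow_le_one₀ hz hz1)) hs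
  refine ⟨h, ?_⟩
  rw [ENNReal.ofReal_tsum_of_nonneg (fun n => mul_nonneg (ha n) (pow_nonneg hz n)) h, gE]
  refine tsum_congr fun n => ?_
  rw [ENNReal.ofReal_mul (ha n), ENNReal.ofReal_pow hz]

/-- functional equation for the minimal measure -/
lemma H_eq (q : ℕ → ℝ) (hq0 : ∀ k, 0 ≤ q k) (hq1 : HasSum q 1)
    (m : ℝ) (hm0 : 0 < m) (hm1 : m < 1)
    (v : ℕ → ℝ) (hmin : IsInvMeasure q m v) (hmin1 : HasSum v 1) (z : ℝ) (hz : 0 ≤ z)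
    (hz1 : z ≤ 1) :
    (∑' n, v n * (∑' k, q k * z ^ k) ^ n) - 1 = m * ((∑' n, v n * z ^ n) - 1) := by
  obtain ⟨hv0, hv00, hv⟩ := hmin
  have key : ∀ z : ℝ≥0∞, gE v (gE q z) =
      (∑' i, ENNReal.ofReal (v i) * ENNReal.ofReal (convPow q i 0))
        + ENNReal.ofReal m * gE v z := by
    intro z
    have hg : gE v z = ∑' j, ENNReal.ofReal (v (j + 1)) * z ^ (j + 1) := by
      rw [gE, tsum_eq_zero_add' ENNReal.summable]
      simp [hv00]
    rw [hg]
    conv_lhs => rw [gE]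
    rw [← gE_comp q hq0, tsum_eq_zero_add' ENNReal.summable, pow_zero, mul_one,
      ← ENNReal.tsum_mul_left]
    congr 1
    refine tsum_congr fun j => ?_
    obtain ⟨h1, h2⟩ := hv (j+1) (by omega)
    rw [← mul_assoc, ← ENNReal.ofReal_mul hm0.le, ← h2, ENNReal.ofReal_tsum_of_nonneg
      (fun i => mul_nonneg (hv0 i) (convPow_nonneg' q hq0 _ _)) h1]
    simp_rw [ENNReal.ofReal_mul (hv0 _)]
  have F1 := (gE_ofReal q hq0 hq1.summable 1 zero_le_one le_rfl).2
  have H1 := (gE_ofReal v hv0 hmin1.summable 1 zero_le_one le_rfl).2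
  simp only [one_pow, mul_one, hq1.tsum_eq, hmin1.tsum_eq, ENNReal.ofReal_one] at F1 H1
  have hc := key 1
  rw [F1, H1, mul_one] at hc
  obtain ⟨sF, hF⟩ := gE_ofReal q hq0 hq1.summable z hz hz1
  obtain ⟨sH, hH⟩ := gE_ofReal v hv0 hmin1.summable z hz hz1
  have F0 : 0 ≤ ∑' k, q k * z ^ k := tsum_nonneg fun n => mul_nonneg (hq0 n) (pow_nonneg hz n)
  have Fle : ∑' k, q k * z ^ k ≤ 1 := by
    rw [← hq1.tsum_eq]
    exact sF.tsum_le_tsum (fun n => mul_le_of_le_one_right (hq0 n) (pow_le_one₀ hz hz1)) hq1.summable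
  obtain ⟨sHF, hHF⟩ := gE_ofReal v hv0 hmin1.summable _ F0 Fle
  have hz' := key (ENNReal.ofReal z)
  rw [hF, hHF, hH] at hz'
  set c := ∑' i, ENNReal.ofReal (v i) * ENNReal.ofReal (convPow q i 0)
  have hcf : c ≠ ⊤ := by
    intro h; rw [h] at hc; simp at hc
  have e1 := congrArg ENNReal.toReal hc
  have e2 := congrArg ENNReal.toReal hz'
  rw [ENNReal.toReal_add hcf ENNReal.ofReal_ne_top, ENNReal.toReal_ofReal hm0.le] at e1
  rw [ENNReal.toReal_add hcf (ENNReal.mul_ne_top ENNReal.ofReal_ne_top ENNReal.ofReal_ne_top),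
    ENNReal.toReal_mul, ENNReal.toReal_ofReal hm0.le,
    ENNReal.toReal_ofReal (tsum_nonneg fun n => mul_nonneg (hv0 n) (pow_nonneg F0 n)),
    ENNReal.toReal_ofReal (tsum_nonneg fun n => mul_nonneg (hv0 n) (pow_nonneg hz n))] at e2
  simp at e1
  linarith

lemma poisson_sum (x h : ℝ) (hx : 0 ≤ x) (hh : 0 ≤ h) :
    ∑' k : ℕ, ENNReal.ofReal (Real.exp (-x) * (x ^ k / k.factorial)) * ENNReal.ofReal h ^ k
      = ENNReal.ofReal (Real.exp ((h - 1) * x)) := by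
  have h1 : HasSum (fun k : ℕ => (x * h) ^ k / k.factorial) (Real.exp (x * h)) := by
    rw [Real.exp_eq_exp_ℝ]
    exact NormedSpace.expSeries_div_hasSum_exp (x * h)
  have h2 := h1.mul_left (Real.exp (-x))
  rw [← Real.exp_add] at h2
  rw [show (h - 1) * x = -x + x * h by ring, ← h2.tsum_eq,
    ENNReal.ofReal_tsum_of_nonneg (fun k => by positivity) h2.summable]
  refine tsum_congr fun k => ?_
  rw [← ENNReal.ofReal_pow hh, ← ENNReal.ofReal_mul (by positivity)]
  congr 1
  rw [mul_pow]; ring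

lemma map_scale (m : ℝ) (hm0 : 0 < m) (Λ : Measure ℝ) (hs : ScaleInvariant m Λ) :
    (Λ.restrict (Ioi 0)).map (fun x => m * x) = Λ.restrict (Ioi 0) := by
  ext A hA
  have hmeas : Measurable (fun x : ℝ => m * x) := by fun_prop
  rw [Measure.map_apply hmeas hA, Measure.restrict_apply (hmeas hA), Measure.restrict_apply hA,
    hs _ ((hmeas hA).inter measurableSet_Ioi) inter_subset_right]
  congr 1
  ext y
  constructor
  · rintro ⟨x, ⟨h1, h2⟩, rfl⟩
    exact ⟨h1, mul_pos hm0 h2⟩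
  · rintro ⟨h1, h2⟩
    refine ⟨y / m, ⟨?_, div_pos h2 hm0⟩, ?_⟩
    · show m * (y / m) ∈ A
      rwa [mul_div_cancel₀ _ hm0.ne']
    · exact mul_div_cancel₀ _ hm0.ne'

lemma mass_down (m : ℝ) (hm0 : 0 < m) (Λ : Measure ℝ) (hs : ScaleInvariant m Λ) (n : ℕ) :
    Λ (Icc (m ^ (n+1)) (m ^ n)) = Λ (Icc m 1) := by
  induction n with
  | zero => simp
  | succ n ih =>
    rw [← ih, hs (Icc (m ^ (n+1)) (m ^ n)) measurableSet_Icc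
      (fun x hx => lt_of_lt_of_le (pow_pos hm0 _) hx.1), Set.image_mul_left_Icc' hm0,
      ← pow_succ', ← pow_succ']

lemma mass_up (m : ℝ) (hm0 : 0 < m) (Λ : Measure ℝ) (hs : ScaleInvariant m Λ) (n : ℕ) :
    Λ (Icc (m⁻¹ ^ n) (m⁻¹ ^ (n+1))) = Λ (Icc m 1) := by
  have h : 0 < m⁻¹ := inv_pos.2 hm0
  have e : ∀ n : ℕ, m * m⁻¹ ^ (n+1) = m⁻¹ ^ n := fun n => by
    rw [pow_succ']; field_simp
  induction n with
  | zero =>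
    rw [hs _ measurableSet_Icc
      (fun x hx => lt_of_lt_of_le (pow_pos h _) hx.1), Set.image_mul_left_Icc' hm0, e]
    simp
  | succ n ih =>
    rw [← ih, hs _ measurableSet_Icc
      (fun x hx => lt_of_lt_of_le (pow_pos h _) hx.1), Set.image_mul_left_Icc' hm0, e, e]

lemma lint_fin (m : ℝ) (hm0 : 0 < m) (hm1 : m < 1) (Λ : Measure ℝ) (hΛ : IsLocFiniteOnPos Λ)
    (hs : ScaleInvariant m Λ) (b c : ℝ) (hb : 0 < b) (hc : 0 < c) :
    ∫⁻ x in Ioi 0, ENNReal.ofReal (Real.exp (-c * x) * x ^ b) ∂Λ < ⊤ := by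
  have hL : Λ (Icc m 1) < ⊤ := hΛ.2 _ isCompact_Icc (fun x hx => lt_of_lt_of_le hm0 hx.1)
  have hr : 1 < m⁻¹ := (one_lt_inv₀ hm0).2 hm1
  -- bound at infinity
  obtain ⟨C, hC0, hC⟩ : ∃ C : ℝ, 0 ≤ C ∧ ∀ x : ℝ, 1 ≤ x → Real.exp (-c * x) * x ^ b ≤ C * x⁻¹ := by
    have ht := tendsto_rpow_mul_exp_neg_mul_atTop_nhds_zero (b + 1) c hc
    obtain ⟨N, hN⟩ := Filter.eventually_atTop.1 (ht.eventually (eventually_le_nhds zero_lt_one))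
    refine ⟨max 1 (max N 1) ^ (b+1) , by positivity, fun x hx => ?_⟩
    have hx0 : 0 < x := by linarith
    rw [← div_eq_mul_inv, le_div_iff₀ hx0, mul_assoc, ← Real.rpow_add_one hx0.ne']
    rcases le_total N x with h | h
    · have := hN x h
      rw [mul_comm]
      refine this.trans (Real.one_le_rpow (le_max_left _ _) (by linarith))
    · have h1 : Real.exp (-c * x) ≤ 1 := Real.exp_le_one_iff.2 (by nlinarith)
      have h2 : x ^ (b+1) ≤ (max 1 (max N 1)) ^ (b+1) :=
        Real.rpow_le_rpow hx0.le (h.trans ((le_max_left _ _).trans (le_max_right _ _))) (by linarith)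
      have h3 : 0 ≤ x ^ (b+1) := by positivity
      nlinarith
  have hcov : Ioi (0:ℝ) ⊆ (⋃ n : ℕ, Icc (m ^ (n+1)) (m ^ n)) ∪
      (⋃ n : ℕ, Icc (m⁻¹ ^ n) (m⁻¹ ^ (n+1))) := by
    intro x hx
    rcases le_total x 1 with h | h
    · obtain ⟨n, h1, h2⟩ := exists_nat_pow_near_of_lt_one hx h hm0 hm1
      exact Or.inl (mem_iUnion.2 ⟨n, h1.le, h2⟩)
    · obtain ⟨n, h1, h2⟩ := exists_nat_pow_near h hr
      exact Or.inr (mem_iUnion.2 ⟨n, h1, h2.le⟩)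
  refine (lintegral_mono_set hcov).trans_lt ((lintegral_union_le _ _ _).trans_lt ?_)
  have geo : ∀ (D r : ℝ) (S : ℕ → Set ℝ), 0 ≤ D → 0 ≤ r → r < 1 → (∀ n, Λ (S n) = Λ (Icc m 1)) →
      (∀ n, MeasurableSet (S n)) →
      (∀ n, ∀ x ∈ S n, Real.exp (-c * x) * x ^ b ≤ D * r ^ n) →
      ∫⁻ x in ⋃ n, S n, ENNReal.ofReal (Real.exp (-c * x) * x ^ b) ∂Λ < ⊤ := by
    intro D r S hD hr0 hr1 hS hSm hbd
    refine (lintegral_iUnion_le _ _).trans_lt ?_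
    have : ∀ n, ∫⁻ x in S n, ENNReal.ofReal (Real.exp (-c * x) * x ^ b) ∂Λ
        ≤ ENNReal.ofReal (D * r ^ n) * Λ (Icc m 1) := by
      intro n
      rw [← hS n, ← setLIntegral_const]
      exact setLIntegral_mono measurable_const (fun x hx => ENNReal.ofReal_le_ofReal (hbd n x hx))
    refine (ENNReal.tsum_le_tsum this).trans_lt ?_
    rw [ENNReal.tsum_mul_right, ← ENNReal.ofReal_tsum_of_nonneg (fun n => by positivity)
      ((summable_geometric_of_lt_one hr0 hr1).mul_left D)]
    exact ENNReal.mul_lt_top ENNReal.ofReal_lt_top hL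
  refine ENNReal.add_lt_top.2 ⟨?_, ?_⟩
  · refine geo 1 (m ^ b) _ zero_le_one (by positivity) (Real.rpow_lt_one hm0.le hm1 hb)
      (mass_down m hm0 Λ hs) (fun n => measurableSet_Icc) ?_
    intro n x hx
    have hx0 : 0 < x := lt_of_lt_of_le (pow_pos hm0 _) hx.1
    have h1 : Real.exp (-c * x) ≤ 1 := Real.exp_le_one_iff.2 (by nlinarith)
    have h2 : x ^ b ≤ (m ^ b) ^ n := by
      rw [← Real.rpow_natCast, ← Real.rpow_mul hm0.le, mul_comm b, Real.rpow_mul hm0.le,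
        Real.rpow_natCast]
      exact Real.rpow_le_rpow hx0.le hx.2 hb.le
    have h3 : 0 ≤ x ^ b := by positivity
    nlinarith
  · refine geo C m _ hC0 hm0.le hm1 (mass_up m hm0 Λ hs) (fun n => measurableSet_Icc) ?_
    intro n x hx
    have h1 : 1 ≤ x := (one_le_pow₀ hr.le).trans hx.1
    refine (hC x h1).trans (mul_le_mul_of_nonneg_left ?_ hC0)
    rw [show m ^ n = (m⁻¹ ^ n)⁻¹ by simp]
    exact inv_anti₀ (by positivity) hx.1

lemma coeff_unique (a b : ℕ → ℝ)
    (h : ∀ z ∈ Ico (0:ℝ) 1, ∃ s, HasSum (fun n => a n * z ^ n) s ∧ HasSum (fun n => b n * z ^ n) s) :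
    a = b := by
  set d : ℕ → ℝ := fun n => a n - b n with hd
  have hs : ∀ z ∈ Ico (0:ℝ) 1, HasSum (fun n => d n * z ^ n) 0 := by
    intro z hz
    obtain ⟨s, h1, h2⟩ := h z hz
    simpa [hd, sub_mul] using h1.sub h2
  set p : FormalMultilinearSeries ℝ ℝ ℝ := FormalMultilinearSeries.ofScalars ℝ d with hp
  have hrad : 0 < p.radius := by
    refine lt_of_lt_of_le (b := ((1/2 : NNReal) : ℝ≥0∞)) (by simp) ?_
    apply FormalMultilinearSeries.le_radius_of_tendsto (l := 0)
    have := (hs (1/2) ⟨by norm_num, by norm_num⟩).summable.tendsto_atTop_zero.norm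
    simpa [hp, FormalMultilinearSeries.ofScalars_norm, abs_mul] using this
  have hf := p.hasFPowerSeriesOnBall hrad
  have hfa := hf.hasFPowerSeriesAt
  have hz : ∃ᶠ z in nhdsWithin (0:ℝ) {0}ᶜ, p.sum z = 0 := by
    have : ∃ᶠ z in nhdsWithin (0:ℝ) (Ioi 0), p.sum z = 0 := by
      apply Filter.Eventually.frequently
      filter_upwards [Ioo_mem_nhdsGT (zero_lt_one (α := ℝ))] with z hz
      have := (hs z ⟨hz.1.le, hz.2⟩).tsum_eq
      rw [FormalMultilinearSeries.sum]
      rw [← this]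
      refine tsum_congr fun n => ?_
      simp [hp, mul_comm]
    exact this.filter_mono (nhdsWithin_mono _ (fun x hx => ne_of_gt hx))
  have hev := (hfa.analyticAt.frequently_zero_iff_eventually_zero).1 hz
  have hp0 := hfa.eq_zero_of_eventually hev
  funext n
  have : d n = 0 := by
    rw [hp, FormalMultilinearSeries.ofScalars_series_eq_zero] at hp0
    exact congrFun hp0 n
  simpa [hd, sub_eq_zero] using this

theorem integral_representation_gives_true_invariant_measure
    (q : ℕ → ℝ) (hq0 : ∀ k, 0 ≤ q k) (hq1 : HasSum q 1)
    (m : ℝ) (hm : HasSum (fun k : ℕ => (k : ℝ) * q k) m) (hm0 : 0 < m) (hm1 : m < 1)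
    (νmin : ℕ → ℝ) (hmin : IsInvMeasure q m νmin) (hmin1 : HasSum νmin 1)
    (α : ℝ) (hα : α < 0)
    (Λ : Measure ℝ) (hΛ : IsLocFiniteOnPos Λ) (hs : ScaleInvariant m Λ) :
    (∀ z ∈ Set.Ico (0 : ℝ) 1,
      IntegrableOn
        (fun x => Real.exp (((∑' n, νmin n * z ^ n) - 1) * x) * x ^ (-α))
        (Set.Ioi 0) Λ) ∧
    ∃ ν : ℕ → ℝ, IsTrueInvMeasure q (m ^ α) ν ∧
      ∀ z ∈ Set.Ico (0 : ℝ) 1,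
        HasSum (fun n => ν n * z ^ n)
          (∫ x in Set.Ioi (0 : ℝ),
            Real.exp (((∑' n, νmin n * z ^ n) - 1) * x) * x ^ (-α) ∂Λ) := by
  have hv0 := hmin.1
  have hv00 := hmin.2.1
  set h : ℝ → ℝ := fun z => ∑' n, νmin n * z ^ n with hh
  have hnn : ∀ z : ℝ, 0 ≤ z → 0 ≤ h z := fun z hz =>
    tsum_nonneg fun n => mul_nonneg (hv0 n) (pow_nonneg hz n)
  have hlt : ∀ z ∈ Set.Ico (0 : ℝ) 1, h z < 1 := by
    intro z hz
    have s1 := (gE_ofReal νmin hv0 hmin1.summable z hz.1 hz.2.le).1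
    have s2 := hmin1.mul_right z
    have : h z ≤ ∑' n, νmin n * z := by
      refine s1.tsum_le_tsum (fun n => ?_) s2.summable
      cases n with
      | zero => simp [hv00]
      | succ n =>
        refine mul_le_mul_of_nonneg_left ?_ (hv0 _)
        rw [pow_succ]
        exact mul_le_of_le_one_left hz.1 (pow_le_one₀ hz.1 hz.2.le)
    rw [s2.tsum_eq] at this
    linarith [hz.2]
  have hfin : ∀ z ∈ Set.Ico (0 : ℝ) 1,
      ∫⁻ x in Ioi 0, ENNReal.ofReal (Real.exp ((h z - 1) * x) * x ^ (-α)) ∂Λ < ⊤ := by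
    intro z hz
    have := lint_fin m hm0 hm1 Λ hΛ hs (-α) (1 - h z) (by linarith) (by linarith [hlt z hz])
    simpa only [neg_sub] using this
  have hae : ∀ z : ℝ, 0 ≤ᵐ[Λ.restrict (Ioi 0)] fun x => Real.exp ((h z - 1) * x) * x ^ (-α) := by
    intro z
    filter_upwards [ae_restrict_mem measurableSet_Ioi] with x hx
    have hx0 : (0:ℝ) < x := hx
    show 0 ≤ Real.exp ((h z - 1) * x) * x ^ (-α)
    positivity
  have hmeas : ∀ z : ℝ, Measurable fun x : ℝ => Real.exp ((h z - 1) * x) * x ^ (-α) := by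
    intro z; fun_prop
  have hint : ∀ z ∈ Set.Ico (0 : ℝ) 1,
      IntegrableOn (fun x => Real.exp ((h z - 1) * x) * x ^ (-α)) (Set.Ioi 0) Λ := by
    intro z hz
    exact ⟨(hmeas z).aestronglyMeasurable, (hasFiniteIntegral_iff_ofReal (hae z)).2 (hfin z hz)⟩
  refine ⟨hint, ?_⟩
  set A : ℕ → ℝ → ℝ≥0∞ := fun n x => ∑' k : ℕ,
    ENNReal.ofReal (Real.exp (-x) * (x ^ k / k.factorial)) * ENNReal.ofReal (convPow νmin k n)
    with hA
  have hAm : ∀ n, Measurable (A n) := by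
    intro n
    refine Measurable.tsum (fun k => ?_)
    fun_prop
  set νE : ℕ → ℝ≥0∞ := fun n => ∫⁻ x in Ioi 0, A n x * ENNReal.ofReal (x ^ (-α)) ∂Λ with hνE
  have hG : ∀ z ∈ Set.Ico (0 : ℝ) 1, ∑' n, νE n * ENNReal.ofReal z ^ n =
      ∫⁻ x in Ioi 0, ENNReal.ofReal (Real.exp ((h z - 1) * x) * x ^ (-α)) ∂Λ := by
    intro z hz
    have hm1 : ∀ n, Measurable fun x : ℝ => A n x * ENNReal.ofReal (x ^ (-α)) := fun n =>
      (hAm n).mul (by fun_prop)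
    simp_rw [hνE]
    simp_rw [← lintegral_mul_const _ (hm1 _)]
    rw [← lintegral_tsum (fun n => ((hm1 n).mul_const _).aemeasurable)]
    refine setLIntegral_congr_fun measurableSet_Ioi (fun x hx => ?_)
    have hx0 : (0:ℝ) < x := hx
    have e := gE_comp νmin hv0 (ENNReal.ofReal z)
      (fun k : ℕ => ENNReal.ofReal (Real.exp (-x) * (x ^ k / k.factorial)))
    rw [(gE_ofReal νmin hv0 hmin1.summable z hz.1 hz.2.le).2,
      poisson_sum x _ hx0.le (hnn z hz.1)] at e
    show ∑' n, A n x * ENNReal.ofReal (x ^ (-α)) * ENNReal.ofReal z ^ n = _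
    rw [ENNReal.ofReal_mul (Real.exp_pos _).le, ← e, ← ENNReal.tsum_mul_right]
    refine tsum_congr fun n => ?_
    rw [mul_right_comm]
  have hνfin : ∀ n, νE n ≠ ⊤ := by
    intro n hn
    have hz : (1/2 : ℝ) ∈ Set.Ico (0:ℝ) 1 := ⟨by norm_num, by norm_num⟩
    have h1 := hfin _ hz
    rw [← hG _ hz] at h1
    have h2 := (ENNReal.le_tsum n).trans_lt h1
    rw [hn, ENNReal.top_mul (pow_ne_zero _ (by simp))] at h2
    exact lt_irrefl _ h2
  set ν : ℕ → ℝ := fun n => (νE n).toReal with hν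
  -- conversion from an extended sum to a real one
  have conv : ∀ (f : ℕ → ℝ≥0∞) (s : ℝ≥0∞) (z : ℝ), 0 ≤ z → s ≠ ⊤ →
      ∑' n, f n * ENNReal.ofReal z ^ n = s → HasSum (fun n => (f n).toReal * z ^ n) s.toReal := by
    intro f s z hz hs' hf
    have := ENNReal.hasSum_toReal (f := fun n => f n * ENNReal.ofReal z ^ n) (by rw [hf]; exact hs')
    rw [← ENNReal.tsum_toReal_eq (f := fun n => f n * ENNReal.ofReal z ^ n)
      (fun n => ENNReal.ne_top_of_tsum_ne_top (by rw [hf]; exact hs') n), hf] at this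
    simpa [ENNReal.toReal_mul, ENNReal.toReal_pow, ENNReal.toReal_ofReal hz] using this
  have hsum : ∀ z ∈ Set.Ico (0 : ℝ) 1, HasSum (fun n => ν n * z ^ n)
      (∫ x in Set.Ioi (0 : ℝ), Real.exp ((h z - 1) * x) * x ^ (-α) ∂Λ) := by
    intro z hz
    rw [integral_eq_lintegral_of_nonneg_ae (hae z) (hmeas z).aestronglyMeasurable]
    exact conv νE _ z hz.1 (hfin z hz).ne (hG z hz)
  refine ⟨ν, ⟨fun n => ENNReal.toReal_nonneg, ?_⟩, hsum⟩
  -- invariance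
  set F : ℝ → ℝ := fun z => ∑' k, q k * z ^ k with hF
  have hF0 : ∀ z ∈ Set.Ico (0 : ℝ) 1, F z ∈ Set.Ico (0 : ℝ) 1 := by
    intro z hz
    refine ⟨tsum_nonneg fun n => mul_nonneg (hq0 n) (pow_nonneg hz.1 n), ?_⟩
    obtain ⟨k, hk, hqk⟩ : ∃ k, k ≠ 0 ∧ q k ≠ 0 := by
      by_contra hcon
      push Not at hcon
      have : (fun k : ℕ => (k : ℝ) * q k) = fun _ => 0 := by
        funext k
        by_cases hk : k = 0
        · simp [hk]
        · simp [hcon k hk]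
      rw [this] at hm
      exact hm0.ne' (hm.unique hasSum_zero)
    rw [← hq1.tsum_eq]
    refine Summable.tsum_lt_tsum (i := k)
      (fun n => mul_le_of_le_one_right (hq0 n) (pow_le_one₀ hz.1 hz.2.le)) ?_
      (gE_ofReal q hq0 hq1.summable z hz.1 hz.2.le).1 hq1.summable
    exact mul_lt_of_lt_one_right (lt_of_le_of_ne (hq0 k) (Ne.symm hqk))
      (pow_lt_one₀ hz.1 hz.2 hk)
  have hscale : ∀ z ∈ Set.Ico (0 : ℝ) 1,
      ∫⁻ x in Ioi 0, ENNReal.ofReal (Real.exp ((h (F z) - 1) * x) * x ^ (-α)) ∂Λ =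
      ENNReal.ofReal (m ^ α) *
        ∫⁻ x in Ioi 0, ENNReal.ofReal (Real.exp ((h z - 1) * x) * x ^ (-α)) ∂Λ := by
    intro z hz
    have hfe : h (F z) - 1 = m * (h z - 1) :=
      H_eq q hq0 hq1 m hm0 hm1 νmin hmin hmin1 z hz.1 hz.2.le
    conv_rhs => rw [← map_scale m hm0 Λ hs]
    rw [lintegral_map (hmeas z).ennreal_ofReal (by fun_prop),
      ← lintegral_const_mul _ (by fun_prop)]
    refine setLIntegral_congr_fun measurableSet_Ioi (fun x hx => ?_)
    have hx0 : (0:ℝ) < x := hx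
    show ENNReal.ofReal _ = ENNReal.ofReal _ * ENNReal.ofReal _
    rw [← ENNReal.ofReal_mul (by positivity), hfe, Real.mul_rpow hm0.le hx0.le]
    congr 1
    have hmm : m ^ α * m ^ (-α) = 1 := by
      rw [← Real.rpow_add hm0]; simp
    calc Real.exp (m * (h z - 1) * x) * x ^ (-α)
        = Real.exp ((h z - 1) * (m * x)) * x ^ (-α) * (m ^ α * m ^ (-α)) := by
          rw [hmm, mul_one]; congr 2; ring
      _ = _ := by ring
  set B : ℕ → ℝ≥0∞ := fun j => ∑' i, νE i * ENNReal.ofReal (convPow q i j) with hB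
  have hBs : ∀ z ∈ Set.Ico (0 : ℝ) 1, ∑' j, B j * ENNReal.ofReal z ^ j =
      ENNReal.ofReal (m ^ α) *
        ∫⁻ x in Ioi 0, ENNReal.ofReal (Real.exp ((h z - 1) * x) * x ^ (-α)) ∂Λ := by
    intro z hz
    rw [hB, gE_comp q hq0, (gE_ofReal q hq0 hq1.summable z hz.1 hz.2.le).2, hG _ (hF0 z hz),
      hscale z hz]
  have hRfin : ∀ z ∈ Set.Ico (0 : ℝ) 1, ENNReal.ofReal (m ^ α) *
        ∫⁻ x in Ioi 0, ENNReal.ofReal (Real.exp ((h z - 1) * x) * x ^ (-α)) ∂Λ ≠ ⊤ :=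
    fun z hz => ENNReal.mul_ne_top ENNReal.ofReal_ne_top (hfin z hz).ne
  have hBfin : ∀ j, B j ≠ ⊤ := by
    intro n hn
    have hz : (1/2 : ℝ) ∈ Set.Ico (0:ℝ) 1 := ⟨by norm_num, by norm_num⟩
    have h1 := hRfin _ hz
    rw [← hBs _ hz] at h1
    have h2 := ENNReal.ne_top_of_tsum_ne_top h1 n
    rw [hn, ENNReal.top_mul (pow_ne_zero _ (by simp))] at h2
    exact h2 rfl
  have hcoef : (fun j => (B j).toReal) = fun j => m ^ α * ν j := by
    refine coeff_unique _ _ fun z hz => ⟨_, conv B _ z hz.1 (hRfin z hz) (hBs z hz), ?_⟩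
    have := (conv νE _ z hz.1 (hfin z hz).ne (hG z hz)).mul_left (m ^ α)
    rw [ENNReal.toReal_mul, ENNReal.toReal_ofReal (by positivity)]
    simpa only [mul_assoc] using this
  intro j
  have hj := hBfin j
  have hsj := ENNReal.hasSum_toReal hj
  have hterm : ∀ i, (νE i * ENNReal.ofReal (convPow q i j)).toReal = ν i * convPow q i j := by
    intro i
    rw [ENNReal.toReal_mul, ENNReal.toReal_ofReal (convPow_nonneg' q hq0 i j)]
  have htot := ENNReal.tsum_toReal_eq (fun i => ENNReal.ne_top_of_tsum_ne_top hj i)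
  simp only [hterm] at hsj htot
  refine ⟨hsj.summable, ?_⟩
  rw [← htot]
  exact congrFun hcoef j
end

section
/- Let m ∈ (0,1) and α ∈ ℝ. Let a ≥ 0 and let M be a Borel measure on (0,∞) with ∫₀^∞ (1 − e^{−x}) M(dx) < ∞, and suppose that a and M are not both zero. Define κ(θ) = a·θ + ∫₀^∞ (1 − e^{−θx}) M(dx) for θ ≥ 0. Then κ(m·θ) = m^α·κ(θ) holds for all θ ≥ 0 if and only if either (i) α ∈ (0,1), a = 0, and the measure Λ defined by Λ(A) = ∫_A x^α M(dx) satisfies Λ(A) = Λ(mA) for every Borel set A ⊆ (0,∞), or (ii) α = 1, a > 0, and M = 0. (Characterization of the Laplace exponents of (α,m)-semi-stable subordinators.) -/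
open MeasureTheory Real Set

/-- Finite measures whose moment generating functions are finite and agree on `(-∞,1)` coincide. -/
lemma laplace_unique (P Q : Measure ℝ) [IsFiniteMeasure P] [IsFiniteMeasure Q]
    (hP : ∀ t < 1, Integrable (fun x => Real.exp (t * x)) P)
    (hQ : ∀ t < 1, Integrable (fun x => Real.exp (t * x)) Q)
    (h : ∀ t < 1, ∫ x, Real.exp (t * x) ∂P = ∫ x, Real.exp (t * x) ∂Q) : P = Q := by
  have sub : ∀ ρ : Measure ℝ, (∀ t < 1, Integrable (fun x => Real.exp (t * x)) ρ) →
      {z : ℂ | z.re < 1} ⊆ {z : ℂ | z.re ∈ interior (ProbabilityTheory.integrableExpSet id ρ)} := by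
    intro ρ hR z hz
    have h1 : Iio (1:ℝ) ⊆ interior (ProbabilityTheory.integrableExpSet id ρ) :=
      interior_maximal (fun t ht => hR t ht) isOpen_Iio
    exact h1 hz
  have aP : AnalyticOnNhd ℂ (ProbabilityTheory.complexMGF id P) {z : ℂ | z.re < 1} :=
    ProbabilityTheory.analyticOnNhd_complexMGF.mono (sub P hP)
  have aQ : AnalyticOnNhd ℂ (ProbabilityTheory.complexMGF id Q) {z : ℂ | z.re < 1} :=
    ProbabilityTheory.analyticOnNhd_complexMGF.mono (sub Q hQ)
  have key : EqOn (ProbabilityTheory.complexMGF id P) (ProbabilityTheory.complexMGF id Q)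
      {z : ℂ | z.re < 1} := by
    refine AnalyticOnNhd.eqOn_of_preconnected_of_frequently_eq aP aQ
      ((convex_Iio (1:ℝ)).linear_preimage Complex.reLm).isPreconnected (z₀ := ((0:ℝ) : ℂ))
      (by simp) ?_
    have h_real : ∃ᶠ (x : ℝ) in nhdsWithin 0 {0}ᶜ, ProbabilityTheory.complexMGF id P x
        = ProbabilityTheory.complexMGF id Q x := by
      apply Filter.Eventually.frequently
      apply Filter.Eventually.filter_mono nhdsWithin_le_nhds
      filter_upwards [Iio_mem_nhds (show (0:ℝ) < 1 by norm_num)] with y hy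
      rw [ProbabilityTheory.complexMGF_ofReal, ProbabilityTheory.complexMGF_ofReal]
      congr 1
      exact h y hy
    rw [Filter.frequently_iff_seq_forall] at h_real ⊢
    obtain ⟨xs, hx_tendsto, hx_eq⟩ := h_real
    refine ⟨fun n ↦ xs n, ?_, fun n ↦ ?_⟩
    · rw [tendsto_nhdsWithin_iff] at hx_tendsto ⊢
      constructor
      · exact (Complex.continuous_ofReal.tendsto 0).comp hx_tendsto.1
      · simpa using hx_tendsto.2
    · simp [hx_eq]
  apply Measure.ext_of_charFun
  funext t
  rw [← ProbabilityTheory.complexMGF_id_mul_I, ← ProbabilityTheory.complexMGF_id_mul_I]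
  exact key (by simp)

/-- Uniqueness of the Lévy measure (zero drift). -/
lemma levy_unique (M N : Measure ℝ) (hM0 : ∀ᵐ x ∂M, 0 < x) (hN0 : ∀ᵐ x ∂N, 0 < x)
    (hM : ∀ θ : ℝ, 0 ≤ θ → Integrable (fun x => 1 - Real.exp (-θ * x)) M)
    (hN : ∀ θ : ℝ, 0 ≤ θ → Integrable (fun x => 1 - Real.exp (-θ * x)) N)
    (h : ∀ θ : ℝ, 0 ≤ θ →
      ∫ x, (1 - Real.exp (-θ * x)) ∂M = ∫ x, (1 - Real.exp (-θ * x)) ∂N) : M = N := by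
  set w : ℝ → ℝ := fun x => Real.exp (-x) * (1 - Real.exp (-x)) with hw
  have hwm : Measurable fun x => ENNReal.ofReal (w x) := by fun_prop
  have wpos : ∀ x : ℝ, 0 < x → 0 < w x := by
    intro x hx
    have : Real.exp (-x) < 1 := by simpa using hx
    have := Real.exp_pos (-x)
    simp only [hw]
    apply mul_pos <;> linarith
  have form : ∀ t x : ℝ, w x * Real.exp (t * x) =
      (1 - Real.exp (-(2 - t) * x)) - (1 - Real.exp (-(1 - t) * x)) := by
    intro t x
    have e1 : Real.exp (-(2 - t) * x) = Real.exp (-x) * Real.exp (-x) * Real.exp (t * x) := by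
      rw [← Real.exp_add, ← Real.exp_add]; ring_nf
    have e2 : Real.exp (-(1 - t) * x) = Real.exp (-x) * Real.exp (t * x) := by
      rw [← Real.exp_add]; ring_nf
    rw [e1, e2]; simp only [hw]; ring
  have gi : ∀ ρ : Measure ℝ, (∀ᵐ x ∂ρ, 0 < x) →
      (∀ θ : ℝ, 0 ≤ θ → Integrable (fun x => 1 - Real.exp (-θ * x)) ρ) →
      ∀ t ≤ 1, Integrable (fun x => Real.exp (t * x))
        (ρ.withDensity fun x => ENNReal.ofReal (w x)) := by
    intro ρ hR0 hR t ht
    rw [integrable_withDensity_iff hwm (by simp)]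
    have := (hR (2 - t) (by linarith)).sub (hR (1 - t) (by linarith))
    refine this.congr ?_
    filter_upwards [hR0] with x hx
    rw [ENNReal.toReal_ofReal (wpos x hx).le, mul_comm, form]
    rfl
  have gv : ∀ ρ : Measure ℝ, (∀ᵐ x ∂ρ, 0 < x) →
      (∀ θ : ℝ, 0 ≤ θ → Integrable (fun x => 1 - Real.exp (-θ * x)) ρ) →
      ∀ t ≤ 1, ∫ x, Real.exp (t * x) ∂(ρ.withDensity fun x => ENNReal.ofReal (w x)) =
        ∫ x, (1 - Real.exp (-(2 - t) * x)) ∂ρ - ∫ x, (1 - Real.exp (-(1 - t) * x)) ∂ρ := by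
    intro ρ hR0 hR t ht
    rw [integral_withDensity_eq_integral_toReal_smul hwm (by simp),
      ← integral_sub (hR (2 - t) (by linarith)) (hR (1 - t) (by linarith))]
    apply integral_congr_ae
    filter_upwards [hR0] with x hx
    rw [ENNReal.toReal_ofReal (wpos x hx).le, smul_eq_mul, form]
  have gf : ∀ ρ : Measure ℝ, (∀ᵐ x ∂ρ, 0 < x) →
      (∀ θ : ℝ, 0 ≤ θ → Integrable (fun x => 1 - Real.exp (-θ * x)) ρ) →
      IsFiniteMeasure (ρ.withDensity fun x => ENNReal.ofReal (w x)) := by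
    intro ρ hR0 hR
    have := gi ρ hR0 hR 0 (by norm_num)
    simp only [zero_mul, Real.exp_zero] at this
    rcases (integrable_const_iff).1 this with h | h
    · norm_num at h
    · exact h
  have gr : ∀ ρ : Measure ℝ, (∀ᵐ x ∂ρ, 0 < x) →
      (ρ.withDensity fun x => ENNReal.ofReal (w x)).withDensity
        (fun x => (ENNReal.ofReal (w x))⁻¹) = ρ := by
    intro ρ hR0
    apply withDensity_inv_same hwm _ (by simp)
    filter_upwards [hR0] with x hx
    simpa using wpos x hx
  have := gf M hM0 hM
  have := gf N hN0 hN
  have e := laplace_unique (M.withDensity fun x => ENNReal.ofReal (w x))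
    (N.withDensity fun x => ENNReal.ofReal (w x))
    (fun t ht => gi M hM0 hM t ht.le) (fun t ht => gi N hN0 hN t ht.le)
    (fun t ht => by
      rw [gv M hM0 hM t ht.le, gv N hN0 hN t ht.le, h _ (by linarith), h _ (by linarith)])
  rw [← gr M hM0, e, gr N hN0]

lemma levy_integrable (M : Measure ℝ) (hM0 : ∀ᵐ x ∂M, 0 < x)
    (hMint : ∫⁻ x, ENNReal.ofReal (1 - Real.exp (-x)) ∂M < ⊤) (θ : ℝ) (hθ : 0 ≤ θ) :
    Integrable (fun x => 1 - Real.exp (-θ * x)) M := by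
  have h1 : Integrable (fun x => 1 - Real.exp (-x)) M := by
    refine ⟨by fun_prop, ?_⟩
    rw [hasFiniteIntegral_iff_ofReal]
    · exact hMint
    · filter_upwards [hM0] with x hx
      simpa using hx.le
  refine (h1.const_mul (θ + 1)).mono' (by fun_prop) ?_
  filter_upwards [hM0] with x hx
  have hx' : 0 ≤ θ * x := by positivity
  have h2 : Real.exp (-θ * x) ≤ 1 := by simpa using hx'
  rw [Real.norm_of_nonneg (by linarith)]
  have h3 := one_add_mul_self_le_rpow_one_add (s := Real.exp (-x) - 1)
    (by linarith [Real.exp_pos (-x)]) (p := θ + 1) (by linarith)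
  have h4 : (1 + (Real.exp (-x) - 1)) ^ (θ + 1) = Real.exp (-x * (θ + 1)) := by
    rw [add_sub_cancel, ← Real.exp_mul]
  rw [h4] at h3
  have h5 : Real.exp (-x * (θ + 1)) ≤ Real.exp (-θ * x) := by
    apply Real.exp_le_exp.2; nlinarith
  linarith

lemma map_withDensity_scale (m : ℝ) (hm : 0 < m) (α : ℝ) (M : Measure ℝ)
    (hM0 : ∀ᵐ x ∂M, 0 < x) :
    (ENNReal.ofReal (m ^ α)) • (M.withDensity fun x => ENNReal.ofReal (x ^ α)).map
      (fun x => m * x) =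
      (M.map (fun x => m * x)).withDensity fun x => ENNReal.ofReal (x ^ α) := by
  have hf : Measurable fun x : ℝ => ENNReal.ofReal (x ^ α) := by fun_prop
  have hT : Measurable fun x : ℝ => m * x := by fun_prop
  ext B hB
  rw [Measure.smul_apply, Measure.map_apply hT hB, withDensity_apply _ (hT hB),
    withDensity_apply _ hB, setLIntegral_map hB hf hT, smul_eq_mul,
    ← lintegral_const_mul _ hf]
  apply lintegral_congr_ae
  filter_upwards [ae_restrict_of_ae hM0] with x hx
  rw [← ENNReal.ofReal_mul (by positivity), Real.mul_rpow hm.le hx.le]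

lemma scaleInvariant_iff_map (m : ℝ) (hm : 0 < m) (Λ : Measure ℝ) (h0 : ∀ᵐ x ∂Λ, 0 < x) :
    ScaleInvariant m Λ ↔ Λ.map (fun x => m * x) = Λ := by
  have hT : Measurable fun x : ℝ => m * x := by fun_prop
  have hinj : Function.Injective fun x : ℝ => m * x := mul_right_injective₀ hm.ne'
  have hsurj : Function.Surjective fun x : ℝ => m * x := mul_left_surjective₀ hm.ne'
  have hemb : MeasurableEmbedding fun x : ℝ => m * x := measurableEmbedding_mulLeft₀ hm.ne'
  constructor
  · intro h
    ext B hB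
    rw [Measure.map_apply hT hB]
    have e1 : Λ ((fun x => m * x) ⁻¹' B) = Λ ((fun x => m * x) ⁻¹' (B ∩ Ioi 0)) := by
      apply measure_congr
      filter_upwards [h0] with x hx
      have hmx : 0 < m * x := by positivity
      exact propext ⟨fun hb => ⟨hb, hmx⟩, fun hb => hb.1⟩
    have e2 : Λ (B ∩ Ioi 0) = Λ B := by
      apply measure_congr
      filter_upwards [h0] with x hx
      exact propext ⟨fun hb => hb.1, fun hb => ⟨hb, hx⟩⟩
    rw [e1, h _ (hT (hB.inter measurableSet_Ioi)), image_preimage_eq _ hsurj, e2]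
    rintro x ⟨-, hx⟩
    exact (mul_pos_iff_of_pos_left hm).1 hx
  · intro h A hA _
    conv_rhs => rw [← h]
    rw [Measure.map_apply hT (hemb.measurableSet_image.2 hA), preimage_image_eq _ hinj]

lemma scaleInvariant_iff (m : ℝ) (hm : 0 < m) (α : ℝ) (M : Measure ℝ)
    (hM0 : ∀ᵐ x ∂M, 0 < x) :
    ScaleInvariant m (M.withDensity fun x => ENNReal.ofReal (x ^ α)) ↔
      M.map (fun x => m * x) = ENNReal.ofReal (m ^ α) • M := by
  have hf : Measurable fun x : ℝ => ENNReal.ofReal (x ^ α) := by fun_prop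
  have hT : Measurable fun x : ℝ => m * x := by fun_prop
  have hc : 0 < m ^ α := Real.rpow_pos_of_pos hm α
  have hc0 : ENNReal.ofReal (m ^ α) ≠ 0 := by simpa using hc
  have hmap0 : ∀ᵐ x ∂(M.map fun x => m * x), 0 < x := by
    rw [ae_map_iff hT.aemeasurable measurableSet_Ioi]
    filter_upwards [hM0] with x hx
    positivity
  rw [scaleInvariant_iff_map m hm _ ((withDensity_absolutelyContinuous _ _).ae_le hM0)]
  have key := map_withDensity_scale m hm α M hM0
  have gr : ∀ ρ : Measure ℝ, (∀ᵐ x ∂ρ, 0 < x) →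
      (ρ.withDensity fun x => ENNReal.ofReal (x ^ α)).withDensity
        (fun x => (ENNReal.ofReal (x ^ α))⁻¹) = ρ := by
    intro ρ hR0
    apply withDensity_inv_same hf _ (by simp)
    filter_upwards [hR0] with x hx
    simpa using Real.rpow_pos_of_pos hx α
  constructor
  · intro h
    rw [h] at key
    rw [← gr _ hmap0, ← key, withDensity_smul_measure, gr M hM0]
  · intro h
    rw [h, withDensity_smul_measure] at key
    ext B hB
    have := congrArg (fun μ : Measure ℝ => μ B) key
    simp only [Measure.smul_apply, smul_eq_mul] at this
    exact (ENNReal.mul_right_inj hc0 ENNReal.ofReal_ne_top).1 this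

theorem semistable_subordinator_characterization
    (m : ℝ) (hm : m ∈ Set.Ioo (0 : ℝ) 1) (α : ℝ)
    (a : ℝ) (ha : 0 ≤ a)
    (M : Measure ℝ) (hM0 : M (Set.Iic 0) = 0)
    (hMint : ∫⁻ x in Set.Ioi (0 : ℝ), ENNReal.ofReal (1 - Real.exp (-x)) ∂M < ⊤)
    (hnz : ¬(a = 0 ∧ M = 0)) :
    (∀ θ : ℝ, 0 ≤ θ →
        a * (m * θ) + ∫ x in Set.Ioi (0 : ℝ), (1 - Real.exp (-(m * θ) * x)) ∂M =
          m ^ α * (a * θ + ∫ x in Set.Ioi (0 : ℝ), (1 - Real.exp (-θ * x)) ∂M)) ↔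
      ((α ∈ Set.Ioo (0 : ℝ) 1 ∧ a = 0 ∧
          ScaleInvariant m (M.withDensity fun x => ENNReal.ofReal (x ^ α))) ∨
        (α = 1 ∧ 0 < a ∧ M = 0)) := by
  obtain ⟨hm0, hm1⟩ := hm
  have hpos : ∀ᵐ x ∂M, 0 < x := by
    rw [ae_iff]
    convert hM0 using 2
    ext x; simp
  have hres : M.restrict (Ioi 0) = M := Measure.restrict_eq_self_of_ae_mem hpos
  rw [hres] at hMint ⊢
  have hI := levy_integrable M hpos hMint
  have hc : 0 < m ^ α := Real.rpow_pos_of_pos hm0 α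
  have hT : Measurable fun x : ℝ => m * x := by fun_prop
  have hemb : MeasurableEmbedding fun x : ℝ => m * x := measurableEmbedding_mulLeft₀ hm0.ne'
  have hmapint : ∀ θ : ℝ, ∫ x, (1 - Real.exp (-θ * x)) ∂(M.map fun x => m * x) =
      ∫ x, (1 - Real.exp (-(m * θ) * x)) ∂M := by
    intro θ
    rw [hemb.integral_map]
    congr 1; funext x; ring_nf
  rw [scaleInvariant_iff m hm0 α M hpos]
  constructor
  · intro h
    by_cases hM : M = 0
    · right
      have ha' : 0 < a := lt_of_le_of_ne ha fun h => hnz ⟨h.symm, hM⟩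
      refine ⟨?_, ha', hM⟩
      have h1 := h 1 zero_le_one
      simp only [hM, integral_zero_measure, add_zero, mul_one] at h1
      have h2 : m ^ α = m ^ (1 : ℝ) := by
        rw [Real.rpow_one]
        apply mul_right_cancel₀ ha'.ne'
        linarith
      exact (Real.rpow_right_inj hm0 hm1.ne).1 h2
    left
    have posint : ∀ f : ℝ → ℝ, Integrable f M → (∀ x, 0 < x → 0 < f x) → 0 < ∫ x, f x ∂M := by
      intro f hf hfp
      have hnn : 0 ≤ᵐ[M] f := by
        filter_upwards [hpos] with x hx using (hfp x hx).le
      refine lt_of_le_of_ne (integral_nonneg_of_ae hnn) fun h0 => hM ?_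
      have := (integral_eq_zero_iff_of_nonneg_ae hnn hf).1 h0.symm
      rw [← ae_eq_bot, ← Filter.empty_mem_iff_bot]
      filter_upwards [this, hpos] with x hx hx2
      have := hfp x hx2
      simp only [Pi.zero_apply] at hx
      linarith
    have h1 := h 1 zero_le_one
    simp only [mul_one] at h1
    have I1 := hI 1 zero_le_one
    have Im := hI m hm0.le
    have A1 : 0 < ∫ x, (1 - Real.exp (-1 * x)) ∂M := by
      apply posint _ I1
      intro x hx
      have : Real.exp (-1 * x) < 1 := by simpa using hx
      linarith
    have A2 : 0 < ∫ x, ((1 - Real.exp (-1 * x)) - (1 - Real.exp (-m * x))) ∂M := by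
      apply posint _ (I1.sub Im)
      intro x hx
      have : Real.exp (-1 * x) < Real.exp (-m * x) := by
        apply Real.exp_lt_exp.2; nlinarith
      simp only [Pi.sub_apply]
      linarith
    rw [integral_sub I1 Im] at A2
    have A3 : 0 < ∫ x, ((1 - Real.exp (-m * x)) - m * (1 - Real.exp (-1 * x))) ∂M := by
      apply posint _ (Im.sub (I1.const_mul m))
      intro x hx
      have := strictConvexOn_exp.2 (mem_univ (-x)) (mem_univ 0) (by linarith) hm0
        (sub_pos.2 hm1) (by ring)
      simp only [smul_eq_mul, mul_zero, add_zero, Real.exp_zero, mul_one] at this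
      rw [show m * -x = -m * x by ring] at this
      simp only [Pi.sub_apply]
      rw [show -1 * x = -x by ring]
      nlinarith
    rw [integral_sub Im (I1.const_mul m), integral_const_mul] at A3
    set p := ∫ x, (1 - Real.exp (-1 * x)) ∂M
    set q := ∫ x, (1 - Real.exp (-m * x)) ∂M
    have hK : 0 < a + p := by linarith
    have hlt1 : m ^ α < 1 := by
      by_contra hcon
      push Not at hcon
      nlinarith
    have hgt : m < m ^ α := by
      by_contra hcon
      push Not at hcon
      nlinarith
    have hα0 : 0 < α := by
      by_contra hcon
      push Not at hcon
      linarith [Real.one_le_rpow_of_pos_of_le_one_of_nonpos hm0 hm1.le hcon]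
    have hα1 : α < 1 := by
      rw [← Real.rpow_lt_rpow_left_iff_of_base_lt_one hm0 hm1, Real.rpow_one]
      exact hgt
    have ha0 : a = 0 := by
      by_contra hane
      have hap : 0 < a := lt_of_le_of_ne ha (Ne.symm hane)
      have hn : ∀ n : ℕ, a + p = (m ^ α) ^ n *
          (a * (m⁻¹) ^ n + ∫ x, (1 - Real.exp (-(m⁻¹) ^ n * x)) ∂M) := by
        intro n
        induction n with
        | zero => simp [p]
        | succ n ih =>
          have := h (m⁻¹ ^ (n + 1)) (by positivity)
          rw [show m * m⁻¹ ^ (n + 1) = m⁻¹ ^ n by rw [pow_succ]; field_simp] at this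
          rw [ih, this]; ring
      have hr : 1 < m ^ α * m⁻¹ := by
        rw [← div_eq_mul_inv, lt_div_iff₀ hm0]; linarith
      obtain ⟨n, hnn⟩ := pow_unbounded_of_one_lt ((a + p) / a) hr
      rw [div_lt_iff₀ hap, mul_pow, hn n] at hnn
      have hnn0 : 0 ≤ ∫ x, (1 - Real.exp (-(m⁻¹) ^ n * x)) ∂M := by
        apply integral_nonneg_of_ae
        filter_upwards [hpos] with x hx
        have : 0 ≤ m⁻¹ ^ n * x := by positivity
        have : Real.exp (-(m⁻¹) ^ n * x) ≤ 1 := by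
          apply Real.exp_le_one_iff.2; linarith
        simpa using this
      have : 0 ≤ (m ^ α) ^ n * ∫ x, (1 - Real.exp (-(m⁻¹) ^ n * x)) ∂M := by positivity
      nlinarith
    refine ⟨⟨hα0, hα1⟩, ha0, ?_⟩
    apply levy_unique
    · rw [ae_map_iff hT.aemeasurable measurableSet_Ioi]
      filter_upwards [hpos] with x hx
      positivity
    · exact Measure.ae_smul_measure hpos _
    · intro θ hθ
      rw [hemb.integrable_map_iff]
      refine (hI (m * θ) (by positivity)).congr (Filter.Eventually.of_forall fun x => ?_)
      simp only [Function.comp]; ring_nf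
    · intro θ hθ
      exact (hI θ hθ).smul_measure ENNReal.ofReal_ne_top
    · intro θ hθ
      have := h θ hθ
      simp only [ha0, zero_mul, zero_add] at this
      rw [hmapint, integral_smul_measure, ENNReal.toReal_ofReal hc.le, smul_eq_mul, this]
  · rintro (⟨-, ha0, hmap⟩ | ⟨rfl, -, rfl⟩) θ hθ
    · rw [← hmapint, hmap, integral_smul_measure, ENNReal.toReal_ofReal hc.le, smul_eq_mul, ha0]
      ring
    · simp; ring
end
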